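/- For all real numbers n, m with n > 0 and m > n/2, there exists a unique real l₀ with max(0, m−n) < l₀ < m − n/2 such that l₀ · e^{1/3} · 2^{4/3} · (n − m + l₀)^{2/3} = φ^{2/3} · (2m − n − 2l₀); in particular this unique l₀ is positive. -/

import Mathlib

open Filter

/-- The constant γ = 79^(3/4)/54^(1/2). -/
noncomputable def gammaK : ℝ := (79 : ℝ) ^ ((3 : ℝ) / 4) / (54 : ℝ) ^ ((1 : ℝ) / 2)

/-- The constant φ = 2·√e·γ²·3^(−3/2). -/
noncomputable def phiC : ℝ := 2 * Real.sqrt (Real.exp 1) * gammaK ^ 2 * (3 : ℝ) ^ (-(3 : ℝ) / 2)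

/-- `l₀` solves the excess equation for `(n, m)`: it lies strictly between
`max 0 (m − n)` and `m − n/2` and satisfies
`l₀ · e^(1/3) · 2^(4/3) · (n − m + l₀)^(2/3) = φ^(2/3) · (2m − n − 2l₀)`. -/
def SolvesExcessEq (n m l₀ : ℝ) : Prop :=
  max 0 (m - n) < l₀ ∧ l₀ < m - n / 2 ∧
    l₀ * Real.exp 1 ^ ((1 : ℝ) / 3) * (2 : ℝ) ^ ((4 : ℝ) / 3) * (n - m + l₀) ^ ((2 : ℝ) / 3)
      = phiC ^ ((2 : ℝ) / 3) * (2 * m - n - 2 * l₀)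

theorem stmt4 (n m : ℝ) (hn : 0 < n) (hm : n / 2 < m) :
    (∃! l₀ : ℝ, SolvesExcessEq n m l₀) ∧
    ∀ l₀ : ℝ, SolvesExcessEq n m l₀ → 0 < l₀ := by
  have hphi : 0 < phiC := by
    unfold phiC gammaK
    positivity
  have hC : 0 < phiC ^ ((2 : ℝ) / 3) := Real.rpow_pos_of_pos hphi _
  have hA : 0 < Real.exp 1 ^ ((1 : ℝ) / 3) := Real.rpow_pos_of_pos (Real.exp_pos 1) _
  have hB : 0 < (2 : ℝ) ^ ((4 : ℝ) / 3) := Real.rpow_pos_of_pos (by norm_num) _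
  have hpos : ∀ l₀ : ℝ, SolvesExcessEq n m l₀ → 0 < l₀ :=
    fun l h => lt_of_le_of_lt (le_max_left _ _) h.1
  refine ⟨?_, hpos⟩
  unfold SolvesExcessEq at *
  generalize phiC ^ ((2 : ℝ) / 3) = C at *
  generalize Real.exp 1 ^ ((1 : ℝ) / 3) = A at *
  generalize (2 : ℝ) ^ ((4 : ℝ) / 3) = B at *
  have hab : max 0 (m - n) < m - n / 2 := max_lt (by linarith) (by linarith)
  -- strict monotonicity, in the form needed for uniqueness
  have hmono : ∀ x y : ℝ, max 0 (m - n) < x → x < y →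
      x * A * B * (n - m + x) ^ ((2 : ℝ) / 3) < y * A * B * (n - m + y) ^ ((2 : ℝ) / 3) := by
    intro x y hx hxy
    have hx0 : 0 < x := lt_of_le_of_lt (le_max_left _ _) hx
    have hx1 : m - n < x := lt_of_le_of_lt (le_max_right _ _) hx
    have h1 : (n - m + x) ^ ((2 : ℝ) / 3) < (n - m + y) ^ ((2 : ℝ) / 3) :=
      Real.rpow_lt_rpow (by linarith) (by linarith) (by norm_num)
    have h2 : 0 < (n - m + x) ^ ((2 : ℝ) / 3) := Real.rpow_pos_of_pos (by linarith) _
    have h3 : x * A * B < y * A * B := by gcongr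
    have h4 : 0 < x * A * B := by positivity
    exact mul_lt_mul'' h3 h1 h4.le h2.le
  let F : ℝ → ℝ := fun l => l * A * B * (n - m + l) ^ ((2 : ℝ) / 3) - C * (2 * m - n - 2 * l)
  have hF : Continuous F := by
    have : Continuous fun l : ℝ => (n - m + l) ^ ((2 : ℝ) / 3) :=
      (Real.continuous_rpow_const (by norm_num)).comp (by fun_prop)
    fun_prop
  have hFa : F (max 0 (m - n)) < 0 := by
    have h0 : max 0 (m - n) * A * B * (n - m + max 0 (m - n)) ^ ((2 : ℝ) / 3) = 0 := by
      rcases max_choice 0 (m - n) with h | h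
      · rw [h]; ring
      · rw [h, show n - m + (m - n) = 0 by ring, Real.zero_rpow (by norm_num), mul_zero]
    have h1 : 0 < C * (2 * m - n - 2 * max 0 (m - n)) := mul_pos hC (by linarith)
    simp only [F]
    rw [h0]
    linarith
  have hFb : 0 < F (m - n / 2) := by
    have h1 : 0 < (n - m + (m - n / 2)) ^ ((2 : ℝ) / 3) := Real.rpow_pos_of_pos (by linarith) _
    have h2 : 0 < m - n / 2 := by linarith
    have h3 : C * (2 * m - n - 2 * (m - n / 2)) = 0 := by ring
    simp only [F]
    rw [h3, sub_zero]
    exact mul_pos (mul_pos (mul_pos h2 hA) hB) h1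
  obtain ⟨l, ⟨hl1, hl2⟩, hl⟩ := intermediate_value_Ioo hab.le hF.continuousOn ⟨hFa, hFb⟩
  have hleq := sub_eq_zero.mp hl
  refine ⟨l, ⟨hl1, hl2, hleq⟩, ?_⟩
  rintro y ⟨hy1, hy2, hy⟩
  rcases lt_trichotomy y l with h | h | h
  · have h1 := hmono y l hy1 h
    have h2 : C * y < C * l := by gcongr
    rw [hy, hleq] at h1
    linarith
  · exact h
  · have h1 := hmono l y hl1 h
    have h2 : C * l < C * y := by gcongr
    rw [hy, hleq] at h1
    linarith
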